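/- Let α > 1 and let 0 < δ < H_3 := (α_0 / (h Σ_{i=1}^n (1 + α^{μ+r_i}) m_i β_i))^{1/μ}. Then ã_1 := α_0 − h (Σ_{i=1}^n (1 + α^{μ+r_i}) m_i β_i) δ^μ > 0, and every φ ∈ S_α with ‖φ‖_H ≤ δ satisfies v(φ) ≥ ã_1 ‖φ(0)‖_{r,p}^γ + w_1 ∫_{−h}^{0} ‖φ(θ)‖_{r,p}^{γ+μ} dθ. -/

import Mathlib

set_option linter.unusedVariables false

noncomputable def hnorm (n : ℕ) (r : Fin n → ℝ) (p : ℝ) (x : Fin n → ℝ) : ℝ :=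
  (∑ i, |x i| ^ (p / r i)) ^ (1 / p)

noncomputable def pd (n : ℕ) (f : (Fin n → ℝ) → (Fin n → ℝ) → (Fin n → ℝ))
    (i j : Fin n) (x y : Fin n → ℝ) : ℝ :=
  deriv (fun t => f (Function.update x j t) y i) (x j)

noncomputable def vfun (n : ℕ) (r : Fin n → ℝ) (p h μ γ w1 w2 : ℝ)
    (f : (Fin n → ℝ) → (Fin n → ℝ) → (Fin n → ℝ)) (V : (Fin n → ℝ) → ℝ)
    (φ : ℝ → Fin n → ℝ) : ℝ :=
  V (φ 0) + fderiv ℝ V (φ 0) (∫ θ in (-h)..(0:ℝ), f (φ 0) (φ θ))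
    + ∫ θ in (-h)..(0:ℝ), (w1 + (h + θ) * w2) * hnorm n r p (φ θ) ^ (γ + μ)

noncomputable def segNorm (n : ℕ) (r : Fin n → ℝ) (p h : ℝ)
    (x : ℝ → Fin n → ℝ) (t : ℝ) : ℝ :=
  sSup ((fun θ => hnorm n r p (x (t + θ))) '' Set.Icc (-h) 0)

def IsSol (n : ℕ) (h : ℝ) (f : (Fin n → ℝ) → (Fin n → ℝ) → (Fin n → ℝ))
    (x : ℝ → Fin n → ℝ) : Prop :=
  ContinuousOn x (Set.Ici (-h)) ∧
  ∀ t : ℝ, 0 ≤ t → HasDerivWithinAt x (f (x t) (x (t - h))) (Set.Ici 0) t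

lemma hnorm_nonneg (n : ℕ) (r : Fin n → ℝ) (p : ℝ) (x : Fin n → ℝ) : 0 ≤ hnorm n r p x :=
  Real.rpow_nonneg (Finset.sum_nonneg fun _ _ => Real.rpow_nonneg (abs_nonneg _) _) _

lemma continuous_hnorm (n : ℕ) (r : Fin n → ℝ) (hr : ∀ i, 0 < r i) (p : ℝ) (hp : 0 ≤ p) :
    Continuous (hnorm n r p) := by
  unfold hnorm
  refine Continuous.rpow_const (continuous_finsetSum _ fun i _ => ?_)
    fun _ => Or.inr (one_div_nonneg.2 hp)
  exact (continuous_apply i).abs.rpow_const fun _ => Or.inr (div_nonneg hp (hr i).le)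

/-- Each coordinate of the integral of a vector field over `[-h, 0]` is at most `h` times a
uniform bound of that coordinate. -/
lemma abs_intervalIntegral_apply_le {n : ℕ} {h : ℝ} (hh : 0 ≤ h) {g : ℝ → Fin n → ℝ}
    (hg : IntervalIntegrable g MeasureTheory.volume (-h) 0) (i : Fin n) {C : ℝ}
    (hC : ∀ θ ∈ Set.Icc (-h) (0 : ℝ), |g θ i| ≤ C) :
    |(∫ θ in (-h)..(0 : ℝ), g θ) i| ≤ C * h := by
  have hcomp : (∫ θ in (-h)..(0 : ℝ), g θ) i = ∫ θ in (-h)..(0 : ℝ), g θ i :=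
    ((ContinuousLinearMap.proj (R := ℝ) (φ := fun _ : Fin n => ℝ) i).intervalIntegral_comp_comm
      hg).symm
  rw [hcomp, ← Real.norm_eq_abs]
  have hbound := intervalIntegral.norm_integral_le_of_norm_le_const
    (f := fun θ => g θ i) (a := -h) (b := 0) (C := C) fun θ hθ => by
      rw [Set.uIoc_of_le (by linarith)] at hθ
      exact hC θ (Set.Ioc_subset_Icc_self hθ)
  simpa [abs_of_nonneg hh] using hbound

lemma abs_continuousLinearMap_apply_le_sum {n : ℕ} (L : (Fin n → ℝ) →L[ℝ] ℝ) (v : Fin n → ℝ) :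
    |L v| ≤ ∑ i, |v i| * |L (Pi.single i 1)| := by
  have hLv : L v = ∑ i, v i * L (Pi.single i 1) := by
    conv_lhs => rw [pi_eq_sum_univ' v, map_sum]
    refine Finset.sum_congr rfl fun i _ => ?_
    rw [map_smul, smul_eq_mul]
  rw [hLv]
  exact (Finset.abs_sum_le_sum_abs _ _).trans_eq (Finset.sum_congr rfl fun i _ => abs_mul _ _)

theorem stmt7
    (n : ℕ) (hn : 1 ≤ n) (r : Fin n → ℝ) (hr : ∀ i, 0 < r i) (p : ℝ) (hp : 1 ≤ p)
    (h μ : ℝ) (hh : 0 < h) (hμ : 0 < μ)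
    (f : (Fin n → ℝ) → (Fin n → ℝ) → (Fin n → ℝ))
    (hf_cont : Continuous fun q : (Fin n → ℝ) × (Fin n → ℝ) => f q.1 q.2)
    (hf_hom : ∀ ε : ℝ, 0 < ε → ∀ x y : Fin n → ℝ, ∀ i,
      f (fun k => ε ^ r k * x k) (fun k => ε ^ r k * y k) i = ε ^ (μ + r i) * f x y i)
    (m : Fin n → ℝ) (hm : ∀ i, 0 < m i)
    (hfm : ∀ x y : Fin n → ℝ, ∀ i,
      |f x y i| ≤ m i * (hnorm n r p x ^ (μ + r i) + hnorm n r p y ^ (μ + r i)))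
    (V : (Fin n → ℝ) → ℝ) (hV : ContDiff ℝ 1 V)
    (α0 α1 γ : ℝ) (hα0 : 0 < α0) (hα1 : 0 < α1) (hγ : ∀ i, 2 * r i ≤ γ)
    (hVlb : ∀ x : Fin n → ℝ, α0 * hnorm n r p x ^ γ ≤ V x)
    (hVub : ∀ x : Fin n → ℝ, V x ≤ α1 * hnorm n r p x ^ γ)
    (β : Fin n → ℝ) (hβ : ∀ i, 0 < β i)
    (hVd : ∀ x : Fin n → ℝ, ∀ i,
      |fderiv ℝ V x (Pi.single i 1)| ≤ β i * hnorm n r p x ^ (γ - r i))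
    (w1 w2 : ℝ) (hw1 : 0 < w1) (hw2 : 0 < w2)
    (α : ℝ) (hα : 1 < α)
    (H3 : ℝ) (hH3def : H3 = (α0 / (h * ∑ i, (1 + α ^ (μ + r i)) * m i * β i)) ^ (1 / μ))
    (δ : ℝ) (hδ0 : 0 < δ) (hδH3 : δ < H3)
    (a1t : ℝ) (ha1tdef : a1t = α0 - h * (∑ i, (1 + α ^ (μ + r i)) * m i * β i) * δ ^ μ)
    :
    0 < a1t ∧ ∀ φ : ℝ → Fin n → ℝ, ContinuousOn φ (Set.Icc (-h) 0) →
      (∀ θ ∈ Set.Icc (-h) (0:ℝ), hnorm n r p (φ θ) ≤ α * hnorm n r p (φ 0)) →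
      (∀ θ ∈ Set.Icc (-h) (0:ℝ), hnorm n r p (φ θ) ≤ δ) →
      a1t * hnorm n r p (φ 0) ^ γ + w1 * ∫ θ in (-h)..(0:ℝ), hnorm n r p (φ θ) ^ (γ + μ)
        ≤ vfun n r p h μ γ w1 w2 f V φ := by
  have hα0' : 0 < α := by linarith
  have hγ0 : 0 < γ := by
    have := hγ ⟨0, hn⟩
    have := hr ⟨0, hn⟩
    linarith
  set S := ∑ i, (1 + α ^ (μ + r i)) * m i * β i with hS
  have hSpos : 0 < S := by
    refine Finset.sum_pos (fun i _ => ?_) ⟨⟨0, hn⟩, Finset.mem_univ _⟩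
    have := hm i
    have := hβ i
    positivity
  have hδpow : δ ^ μ < α0 / (h * S) := by
    have := Real.rpow_lt_rpow hδ0.le (hH3def ▸ hδH3) hμ
    rwa [one_div, Real.rpow_inv_rpow (by positivity) hμ.ne'] at this
  refine ⟨?_, fun φ hφ hφα hφδ => ?_⟩
  · rw [lt_div_iff₀ (by positivity)] at hδpow
    rw [ha1tdef]
    linarith
  have hN : Continuous (hnorm n r p) := continuous_hnorm n r hr p (by linarith)
  have h0mem : (0 : ℝ) ∈ Set.Icc (-h) 0 := ⟨by linarith, le_rfl⟩
  have huIcc : Set.uIcc (-h) 0 = Set.Icc (-h) 0 := Set.uIcc_of_le (by linarith)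
  set A := hnorm n r p (φ 0) with hA
  have hA0 : 0 ≤ A := hnorm_nonneg ..
  have hgrad : |fderiv ℝ V (φ 0) (∫ θ in (-h)..(0 : ℝ), f (φ 0) (φ θ))|
      ≤ h * S * δ ^ μ * A ^ γ := by
    have hfint : IntervalIntegrable (fun θ => f (φ 0) (φ θ)) MeasureTheory.volume (-h) 0 := by
      apply ContinuousOn.intervalIntegrable
      rw [huIcc]
      exact hf_cont.comp_continuousOn (continuousOn_const.prodMk hφ)
    have hfi (i : Fin n) : |(∫ θ in (-h)..(0 : ℝ), f (φ 0) (φ θ)) i|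
        ≤ (1 + α ^ (μ + r i)) * m i * A ^ (μ + r i) * h := by
      refine abs_intervalIntegral_apply_le hh.le hfint i fun θ hθ => ?_
      have hpow : hnorm n r p (φ θ) ^ (μ + r i) ≤ α ^ (μ + r i) * A ^ (μ + r i) := by
        rw [← Real.mul_rpow hα0'.le hA0]
        exact Real.rpow_le_rpow (hnorm_nonneg ..) (hφα θ hθ) (by linarith [hr i])
      refine (hfm (φ 0) (φ θ) i).trans ?_
      calc m i * (A ^ (μ + r i) + hnorm n r p (φ θ) ^ (μ + r i))
          ≤ m i * (A ^ (μ + r i) + α ^ (μ + r i) * A ^ (μ + r i)) := by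
            have := hm i
            gcongr
        _ = _ := by ring
    calc _ ≤ ∑ i, |(∫ θ in (-h)..(0 : ℝ), f (φ 0) (φ θ)) i|
              * |fderiv ℝ V (φ 0) (Pi.single i 1)| := abs_continuousLinearMap_apply_le_sum _ _
      _ ≤ ∑ i, ((1 + α ^ (μ + r i)) * m i * A ^ (μ + r i) * h) * (β i * A ^ (γ - r i)) := by
          refine Finset.sum_le_sum fun i _ => ?_
          exact mul_le_mul (hfi i) (hVd (φ 0) i) (abs_nonneg _) ((abs_nonneg _).trans (hfi i))
      _ = h * S * A ^ μ * A ^ γ := by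
          rw [hS, Finset.mul_sum, Finset.sum_mul, Finset.sum_mul]
          refine Finset.sum_congr rfl fun i _ => ?_
          have hpow : A ^ (μ + r i) * A ^ (γ - r i) = A ^ μ * A ^ γ := by
            rw [← Real.rpow_add_of_nonneg hA0 (by linarith [hr i]) (by linarith [hr i, hγ i]),
              ← Real.rpow_add_of_nonneg hA0 hμ.le hγ0.le]
            ring_nf
          linear_combination h * ((1 + α ^ (μ + r i)) * m i * β i) * hpow
      _ ≤ h * S * δ ^ μ * A ^ γ := by
          have := hφδ 0 h0mem
          gcongr
  have hpowcont : ContinuousOn (fun θ => hnorm n r p (φ θ) ^ (γ + μ)) (Set.Icc (-h) 0) :=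
    (hN.comp_continuousOn hφ).rpow_const fun _ _ => Or.inr (by linarith)
  have hint : w1 * ∫ θ in (-h)..(0 : ℝ), hnorm n r p (φ θ) ^ (γ + μ)
      ≤ ∫ θ in (-h)..(0 : ℝ), (w1 + (h + θ) * w2) * hnorm n r p (φ θ) ^ (γ + μ) := by
    rw [← intervalIntegral.integral_const_mul]
    refine intervalIntegral.integral_mono_on (by linarith) ?_ ?_ fun θ hθ => ?_
    · apply ContinuousOn.intervalIntegrable
      rw [huIcc]
      exact continuousOn_const.mul hpowcont
    · apply ContinuousOn.intervalIntegrable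
      rw [huIcc]
      exact ContinuousOn.mul (by fun_prop) hpowcont
    · refine mul_le_mul_of_nonneg_right ?_ (Real.rpow_nonneg (hnorm_nonneg ..) _)
      have := mul_nonneg (by linarith [hθ.1] : 0 ≤ h + θ) hw2.le
      linarith
  have hVφ := hVlb (φ 0)
  have hgrad_lower := (abs_le.1 hgrad).1
  rw [vfun, ha1tdef, sub_mul]
  linarith
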